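/- arXiv:2503.12448 — 2 statements merged into one kernel-verified Lean document; each statement's English description precedes it below -/
import Mathlib

section
/- For every vector k ∈ ℝ³ there exist ξ₁, ξ₂ ∈ ℂ³ such that ξ₁ · ξ₁ = 0, ξ₂ · ξ₂ = 0, and ξ₁ + ξ₂ = i k (where k is regarded as an element of ℂ³ via the real embedding). -/
/-- Every `k ∈ ℝ³` has an orthogonal vector of the same length. -/
lemma exists_orthogonal_same_length (k : Fin 3 → ℝ) :
    ∃ w : Fin 3 → ℝ, ∑ j, w j * k j = 0 ∧ ∑ j, w j * w j = ∑ j, k j * k j := by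
  simp only [Fin.sum_univ_three]
  by_cases hs : k 0 ^ 2 + k 1 ^ 2 = 0
  · have h0 : k 0 = 0 := by nlinarith [sq_nonneg (k 0), sq_nonneg (k 1)]
    have h1 : k 1 = 0 := by nlinarith [sq_nonneg (k 0), sq_nonneg (k 1)]
    exact ⟨![k 2, 0, 0], by simp [h0], by simp [h0, h1]⟩
  · set t := √((k 0 ^ 2 + k 1 ^ 2 + k 2 ^ 2) / (k 0 ^ 2 + k 1 ^ 2))
    have ht : t ^ 2 * (k 0 ^ 2 + k 1 ^ 2) = k 0 ^ 2 + k 1 ^ 2 + k 2 ^ 2 := by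
      rw [Real.sq_sqrt (by positivity), div_mul_cancel₀ _ hs]
    refine ⟨![-(t * k 1), t * k 0, 0], ?_, ?_⟩
    · simp
      ring
    · simp
      linear_combination ht

/-- For every `k ∈ ℝ³` there exist complex null vectors `ξ₁, ξ₂ ∈ ℂ³`
(with respect to the complex bilinear dot product) with `ξ₁ + ξ₂ = i k`. -/
theorem exists_complex_null_vectors_sum_eq_I_smul (k : Fin 3 → ℝ) :
    ∃ ξ₁ ξ₂ : Fin 3 → ℂ,
      (∑ j, ξ₁ j * ξ₁ j) = 0 ∧
      (∑ j, ξ₂ j * ξ₂ j) = 0 ∧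
      (∀ j, ξ₁ j + ξ₂ j = Complex.I * (k j : ℂ)) := by
  obtain ⟨w, hwk, hww⟩ := exists_orthogonal_same_length k
  have hwk' := congrArg (fun x : ℝ => (x : ℂ)) hwk
  have hww' := congrArg (fun x : ℝ => (x : ℂ)) hww
  simp only [Fin.sum_univ_three] at hwk' hww' ⊢
  push_cast at hwk' hww'
  refine ⟨fun j => (Complex.I * k j + w j) / 2, fun j => (Complex.I * k j - w j) / 2,
    ?_, ?_, fun j => by ring⟩
  · linear_combination (Complex.I / 2) * hwk' + hww' / 4 +
      ((k 0 : ℂ) ^ 2 + k 1 ^ 2 + k 2 ^ 2) / 4 * Complex.I_sq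
  · linear_combination (-Complex.I / 2) * hwk' + hww' / 4 +
      ((k 0 : ℂ) ^ 2 + k 1 ^ 2 + k 2 ^ 2) / 4 * Complex.I_sq
end

section
/- Let n ≥ 1, let m ≥ 2 be an integer, let q : ℝⁿ → ℝ be a function, and let U : ℝ^m × ℝⁿ → ℝ be jointly C^∞-smooth with U(0,x) = 0 for all x ∈ ℝⁿ and Δ_x U(ε,x) + q(x) U(ε,x)^m = 0 for all ε ∈ ℝ^m and x ∈ ℝⁿ. Define v_j(x) = ∂_{ε_j}U(ε,x)|_{ε=0} for j = 1,…,m and w(x) = ∂_{ε₁}∂_{ε₂}⋯∂_{ε_m}U(ε,x)|_{ε=0}. Then Δ v_j = 0 for every j, and Δ w(x) = −m! · q(x) · ∏_{j=1}^{m} v_j(x) for all x ∈ ℝⁿ. -/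
/-- The Laplacian of a real-valued function on `ℝⁿ`, as the sum of its second partial
derivatives in the coordinate directions. -/
noncomputable def laplacian {n : ℕ} (f : (Fin n → ℝ) → ℝ) (x : Fin n → ℝ) : ℝ :=
  ∑ j, fderiv ℝ (fun y => fderiv ℝ f y (Pi.single j 1)) x (Pi.single j 1)

open scoped ContDiff

section DirectionalDerivatives

variable {E F : Type*} [NormedAddCommGroup E] [NormedSpace ℝ E]
  [NormedAddCommGroup F] [NormedSpace ℝ F]

theorem ContDiff.fderiv_apply_const {f : E → ℝ} (hf : ContDiff ℝ ∞ f) (a : E) :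
    ContDiff ℝ ∞ (fun y => fderiv ℝ f y a) :=
  (hf.fderiv_right (by simp)).clm_apply contDiff_const

theorem ContDiff.iteratedFDeriv_succ_eq_fderiv_last {f : E → ℝ} (hf : ContDiff ℝ ∞ f) {k : ℕ}
    (x : E) (vs : Fin (k + 1) → E) :
    iteratedFDeriv ℝ (k + 1) f x vs =
      iteratedFDeriv ℝ k (fun y => fderiv ℝ f y (vs (Fin.last k))) x (Fin.init vs) := by
  have hd : ContDiff ℝ ∞ (fderiv ℝ f) := hf.fderiv_right (by simp)
  have h := (ContinuousLinearMap.apply ℝ ℝ (vs (Fin.last k))).iteratedFDeriv_comp_left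
    hd.contDiffAt (x := x) (i := k) (by exact_mod_cast le_top)
  rw [iteratedFDeriv_succ_apply_right]
  exact (congrArg (fun T => T (Fin.init vs)) h).symm

theorem ContDiff.fderiv_fderiv_apply_comm {f : E → ℝ} (hf : ContDiff ℝ ∞ f) (x a b : E) :
    fderiv ℝ (fun y => fderiv ℝ f y a) x b = fderiv ℝ (fun y => fderiv ℝ f y b) x a := by
  have hd : DifferentiableAt ℝ (fderiv ℝ f) x :=
    (hf.fderiv_right (m := ∞) (by simp)).differentiable (by simp) x
  have hs : IsSymmSndFDerivAt ℝ f x :=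
    hf.contDiffAt.isSymmSndFDerivAt (by simpa using WithTop.coe_le_coe.2 (le_top : (2 : ℕ∞) ≤ ⊤))
  rw [fderiv_clm_apply hd (by fun_prop), fderiv_clm_apply hd (by fun_prop)]
  simpa using hs.eq b a

/-- The directional derivative along `a` commutes with `f ↦ ∑ j, ∂_{b j} ∂_{b j} f`. -/
theorem ContDiff.fderiv_sum_fderiv_fderiv {ι : Type*} [Fintype ι] {f : E → ℝ}
    (hf : ContDiff ℝ ∞ f) (b : ι → E) (a x : E) :
    fderiv ℝ (fun z => ∑ j, fderiv ℝ (fun y => fderiv ℝ f y (b j)) z (b j)) x a =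
      ∑ j, fderiv ℝ (fun y => fderiv ℝ (fun z => fderiv ℝ f z a) y (b j)) x (b j) := by
  have hd (j : ι) := (hf.fderiv_apply_const (b j)).fderiv_apply_const (b j)
  rw [fderiv_fun_sum fun j _ => (hd j).differentiable (by simp) x]
  simp only [FunLike.coe_sum, Finset.sum_apply]
  refine Finset.sum_congr rfl fun j _ => ?_
  rw [(hf.fderiv_apply_const (b j)).fderiv_fderiv_apply_comm]
  simp only [hf.fderiv_fderiv_apply_comm _ (b j) a]

theorem ContDiff.iteratedFDeriv_sum_fderiv_fderiv {ι : Type*} [Fintype ι] (b : ι → E) {k : ℕ} :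
    ∀ {f : E → ℝ}, ContDiff ℝ ∞ f → ∀ (x : E) (vs : Fin k → E),
    iteratedFDeriv ℝ k (fun z => ∑ j, fderiv ℝ (fun y => fderiv ℝ f y (b j)) z (b j)) x vs =
      ∑ j, fderiv ℝ (fun y => fderiv ℝ (fun z => iteratedFDeriv ℝ k f z vs) y (b j)) x (b j) := by
  induction k with
  | zero => intro f _ x vs; simp
  | succ k ih =>
    intro f hf x vs
    have hd : ContDiff ℝ ∞ (fun z => ∑ j, fderiv ℝ (fun y => fderiv ℝ f y (b j)) z (b j)) :=
      ContDiff.sum fun j _ => (hf.fderiv_apply_const (b j)).fderiv_apply_const (b j)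
    simp only [hd.iteratedFDeriv_succ_eq_fderiv_last, hf.iteratedFDeriv_succ_eq_fderiv_last,
      hf.fderiv_sum_fderiv_fderiv]
    exact ih (hf.fderiv_apply_const _) x _

theorem ContDiff.fderiv_slice_left {f : E × F → ℝ} (hf : ContDiff ℝ ∞ f) (x a : E) (y : F) :
    fderiv ℝ (fun z => f (z, y)) x a = fderiv ℝ f (x, y) (a, 0) := by
  have h := ((hf.differentiable (by simp) (x, y)).hasFDerivAt).comp x
    (hasFDerivAt_prodMk_left (𝕜 := ℝ) x y)
  simpa [Function.comp_def] using congrArg (fun T => T a) h.fderiv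

theorem ContDiff.fderiv_slice_right {f : E × F → ℝ} (hf : ContDiff ℝ ∞ f) (x : E) (y a : F) :
    fderiv ℝ (fun z => f (x, z)) y a = fderiv ℝ f (x, y) (0, a) := by
  have h := ((hf.differentiable (by simp) (x, y)).hasFDerivAt).comp y
    (hasFDerivAt_prodMk_right (𝕜 := ℝ) x y)
  simpa [Function.comp_def] using congrArg (fun T => T a) h.fderiv

theorem ContDiff.iteratedFDeriv_slice_left {k : ℕ} :
    ∀ {f : E × F → ℝ}, ContDiff ℝ ∞ f → ∀ (x : E) (y : F) (vs : Fin k → E),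
    iteratedFDeriv ℝ k (fun z => f (z, y)) x vs =
      iteratedFDeriv ℝ k f (x, y) (fun i => (vs i, 0)) := by
  induction k with
  | zero => intro f _ x y vs; simp
  | succ k ih =>
    intro f hf x y vs
    have hs : ContDiff ℝ ∞ (fun z => f (z, y)) := hf.comp (contDiff_id.prodMk contDiff_const)
    rw [hs.iteratedFDeriv_succ_eq_fderiv_last, hf.iteratedFDeriv_succ_eq_fderiv_last]
    simp only [hf.fderiv_slice_left]
    exact ih (hf.fderiv_apply_const _) x y _

theorem ContDiff.iteratedFDeriv_apply_const {k : ℕ} :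
    ∀ {f : E → ℝ}, ContDiff ℝ ∞ f → ∀ vs : Fin k → E,
    ContDiff ℝ ∞ (fun x => iteratedFDeriv ℝ k f x vs) := by
  induction k with
  | zero => intro f hf vs; simpa using hf
  | succ k ih =>
    intro f hf vs
    simp only [hf.iteratedFDeriv_succ_eq_fderiv_last]
    exact ih (hf.fderiv_apply_const _) _

/-- At a zero of `f`, the `k`-th derivative of `g * f ^ k` only sees first derivatives of `f`. -/
theorem ContDiff.iteratedFDeriv_mul_pow_of_eq_zero {f : E → ℝ} (hf : ContDiff ℝ ∞ f) {x : E}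
    (hx : f x = 0) {k : ℕ} : ∀ {g : E → ℝ}, ContDiff ℝ ∞ g → ∀ vs : Fin k → E,
    iteratedFDeriv ℝ k (fun y => g y * f y ^ k) x vs =
      k.factorial * g x * ∏ i, fderiv ℝ f x (vs i) := by
  induction k with
  | zero => intro g _ vs; simp
  | succ k ih =>
    intro g hg vs
    have hgd := hg.differentiable (by simp)
    have hfd := hf.differentiable (by simp)
    have hstep (a : E) : (fun y => fderiv ℝ (fun y => g y * f y ^ (k + 1)) y a) =
        fun y => (fderiv ℝ g y a * f y + (k + 1) * (g y * fderiv ℝ f y a)) * f y ^ k := by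
      funext y
      rw [fderiv_fun_mul (hgd y) ((hfd y).fun_pow _), fderiv_fun_pow _ (hfd y)]
      simp
      ring
    rw [(hg.mul (hf.pow (k + 1))).iteratedFDeriv_succ_eq_fderiv_last, hstep,
      ih (((hg.fderiv_apply_const _).mul hf).add
        (contDiff_const.mul (hg.mul (hf.fderiv_apply_const _)))),
      Fin.prod_univ_castSucc, hx, Nat.factorial_succ]
    simp only [Fin.init]
    push_cast
    ring

end DirectionalDerivatives

theorem laplacian_slice_right {E : Type*} [NormedAddCommGroup E] [NormedSpace ℝ E] {n : ℕ}
    {f : E × (Fin n → ℝ) → ℝ} (hf : ContDiff ℝ ∞ f) (ε : E) (x : Fin n → ℝ) :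
    laplacian (fun y => f (ε, y)) x =
      ∑ j, fderiv ℝ (fun p => fderiv ℝ f p (0, Pi.single j 1)) (ε, x) (0, Pi.single j 1) := by
  simp only [laplacian, hf.fderiv_slice_right,
    (hf.fderiv_apply_const _).fderiv_slice_right]

/-- `m`-th order multiple-linearization identity for the semilinear equation
`Δu + q uᵐ = 0`: if `U(ε,x)`, `ε ∈ ℝᵐ`, is a jointly smooth `m`-parameter family of
solutions with `U(0,·) = 0`, then the first linearizations `v_j = ∂_{ε_j}U|_{ε=0}` are
harmonic and the mixed derivative `w = ∂_{ε₁}⋯∂_{ε_m}U|_{ε=0}` satisfies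
`Δw = -m! · q · v₁⋯v_m`. -/
theorem multiple_linearization_semilinear (n : ℕ) (hn : 1 ≤ n) (m : ℕ) (hm : 2 ≤ m)
    (q : (Fin n → ℝ) → ℝ)
    (U : (Fin m → ℝ) → (Fin n → ℝ) → ℝ)
    (hU : ContDiff ℝ (⊤ : ℕ∞) (fun p : (Fin m → ℝ) × (Fin n → ℝ) => U p.1 p.2))
    (hU0 : ∀ x, U 0 x = 0)
    (hPDE : ∀ ε : Fin m → ℝ, ∀ x, laplacian (U ε) x + q x * (U ε x) ^ m = 0)
    (v : Fin m → (Fin n → ℝ) → ℝ)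
    (hv : ∀ j x, v j x = fderiv ℝ (fun ε => U ε x) 0 (Pi.single j 1))
    (w : (Fin n → ℝ) → ℝ)
    (hw : ∀ x, w x = iteratedFDeriv ℝ m (fun ε => U ε x) 0 (fun i => Pi.single i 1)) :
    (∀ j, ∀ x, laplacian (v j) x = 0) ∧
      (∀ x, laplacian w x = -(m.factorial : ℝ) * q x * ∏ j, v j x) := by
  have hslice (x : Fin n → ℝ) : ContDiff ℝ ∞ (fun ε => U ε x) :=
    hU.comp (contDiff_id.prodMk contDiff_const)
  set f : (Fin m → ℝ) × (Fin n → ℝ) → ℝ := fun p => U p.1 p.2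
  let b : Fin n → (Fin m → ℝ) × (Fin n → ℝ) := fun j => (0, Pi.single j 1)
  let L : (Fin m → ℝ) × (Fin n → ℝ) → ℝ :=
    fun z => ∑ j, fderiv ℝ (fun y => fderiv ℝ f y (b j)) z (b j)
  have hL : ContDiff ℝ ∞ L :=
    ContDiff.sum fun j _ => (hU.fderiv_apply_const (b j)).fderiv_apply_const (b j)
  have hLU (x : Fin n → ℝ) : (fun ε => L (ε, x)) = fun ε => -q x * U ε x ^ m := by
    funext ε
    have h : laplacian (U ε) x = L (ε, x) := laplacian_slice_right hU ε x
    linarith [hPDE ε x]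
  constructor
  · intro j x
    have hvj : v j = fun y => fderiv ℝ f (0, y) (Pi.single j 1, 0) :=
      funext fun y => (hv j y).trans (hU.fderiv_slice_left _ _ _)
    rw [hvj, laplacian_slice_right (hU.fderiv_apply_const _),
      ← hU.fderiv_sum_fderiv_fderiv b, ← hL.fderiv_slice_left, hLU,
      fderiv_const_mul (((hslice x).differentiable (by simp) 0).fun_pow m),
      fderiv_fun_pow _ ((hslice x).differentiable (by simp) 0)]
    simp [hU0, show m - 1 ≠ 0 by omega]
  · intro x
    have hwf : w = fun y => iteratedFDeriv ℝ m f (0, y) (fun i => (Pi.single i 1, 0)) :=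
      funext fun y => (hw y).trans (hU.iteratedFDeriv_slice_left _ _ _)
    rw [hwf, laplacian_slice_right (hU.iteratedFDeriv_apply_const _),
      ← hU.iteratedFDeriv_sum_fderiv_fderiv b, ← hL.iteratedFDeriv_slice_left, hLU,
      (hslice x).iteratedFDeriv_mul_pow_of_eq_zero (hU0 x) contDiff_const]
    simp only [hv]
    ring
end
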